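/- Let x ∈ G, I = I(x), B = B(x), A = A(x), and let S be the associated constraint set. Then h(ν, δ) ≥ 0 for every (ν, δ) ∈ S. Consequently, for p = −Σ_{i∈A} ν_i b_i + δ with (ν, δ) ∈ S, the Hamiltonian satisfies H(p) = h(ν, δ) ≥ 0. -/

import Mathlib

open Real

noncomputable section

/-- Euclidean dot product on `ℝ^J`. -/
def dotJ {J : ℕ} (p q : Fin J → ℝ) : ℝ := ∑ j, p j * q j

/-- `γ_i = e_i − e_{i+1}` for `i < J`, and `γ_J = e_J` (0-indexed). -/
def gam (J : ℕ) (i : Fin J) : Fin J → ℝ :=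
  fun j => (if j = i then (1 : ℝ) else 0) - (if (j : ℕ) = (i : ℕ) + 1 then (1 : ℝ) else 0)

/-- `b_i = β_i (e_1 + ⋯ + e_i)` (0-indexed: coordinates `j ≤ i`). -/
def bvec {J : ℕ} (β : Fin J → ℝ) (i : Fin J) : Fin J → ℝ :=
  fun j => if (j : ℕ) ≤ (i : ℕ) then β i else 0

/-- The domain `G`. -/
def domG {J : ℕ} [NeZero J] (z : Fin J → ℝ) : Set (Fin J → ℝ) :=
  {x | (∀ i, 0 ≤ x i) ∧ x 0 < z 0 ∧ ∀ i : Fin J, i ≠ 0 → x i ≤ z i}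

/-- The boundary portion `∂_o G`. -/
def bdO {J : ℕ} [NeZero J] (z : Fin J → ℝ) : Set (Fin J → ℝ) :=
  {x | x 0 = z 0 ∧ ∀ i : Fin J, i ≠ 0 → 0 ≤ x i ∧ x i ≤ z i}

/-- The boundary portion `∂_c G`. -/
def bdC {J : ℕ} [NeZero J] (z : Fin J → ℝ) : Set (Fin J → ℝ) :=
  {x | x ∈ domG z ∧ ∃ i : Fin J, i ≠ 0 ∧ x i = z i}

/-- The Hamiltonian `H(p) = c + λ(1 − e^{−p_1}) + Σ_i max(0, μ_i(1 − e^{γ_i·p}))`. -/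
def Ham {J : ℕ} [NeZero J] (lam c : ℝ) (μ : Fin J → ℝ) (p : Fin J → ℝ) : ℝ :=
  c + lam * (1 - Real.exp (-(p 0))) +
    ∑ i, max 0 (μ i * (1 - Real.exp (dotJ (gam J i) p)))

/-- Superdifferential of `V` at `x`, relative to the set `G`. -/
def supDiff {J : ℕ} (G : Set (Fin J → ℝ)) (V : (Fin J → ℝ) → ℝ) (x : Fin J → ℝ) :
    Set (Fin J → ℝ) :=
  {p | ∀ ε > 0, ∃ r > 0, ∀ y ∈ G, ‖y - x‖ < r →
    V y - V x - dotJ p (y - x) ≤ ε * ‖y - x‖}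

/-- Subdifferential of `V` at `x`, relative to the set `G`. -/
def subDiff {J : ℕ} (G : Set (Fin J → ℝ)) (V : (Fin J → ℝ) → ℝ) (x : Fin J → ℝ) :
    Set (Fin J → ℝ) :=
  {p | ∀ ε > 0, ∃ r > 0, ∀ y ∈ G, ‖y - x‖ < r →
    -(ε * ‖y - x‖) ≤ V y - V x - dotJ p (y - x)}

/-- `A' = {i : μ_i ≤ μ_j for all j < i}`. -/
def Aprime {J : ℕ} (μ : Fin J → ℝ) : Set (Fin J) := {i | ∀ j, j < i → μ i ≤ μ j}

/-- `A(x) = {i ∈ A' : i+1 ∉ B(x), or every j > i with [i+1,j] ⊆ B(x) has μ_i < μ_j}`. -/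
def Aset {J : ℕ} (μ z x : Fin J → ℝ) : Set (Fin J) :=
  {i | i ∈ Aprime μ ∧
    ((∀ h : (i : ℕ) + 1 < J, x ⟨(i : ℕ) + 1, h⟩ ≠ z ⟨(i : ℕ) + 1, h⟩) ∨
      ∀ j : Fin J, i < j → (∀ k : Fin J, i < k → k ≤ j → x k = z k) → μ i < μ j)}

/-- `l(x) = x log x − x + 1` (finite branch; `Real.log 0 = 0` gives `0·log 0 = 0`). -/
def lfun (x : ℝ) : ℝ := x * Real.log x - x + 1

/-- The control set `U = [0,1]^J`. -/
def Uset (J : ℕ) : Set (Fin J → ℝ) := {u | ∀ i, 0 ≤ u i ∧ u i ≤ 1}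

/-- The perturbation set `M = {(λ̄, μ̄) : λ̄ ≥ 0, μ̄_i ≥ 0}`. -/
def Mset (J : ℕ) : Set (ℝ × (Fin J → ℝ)) := {m | 0 ≤ m.1 ∧ ∀ i, 0 ≤ m.2 i}

/-- `H(p,u,m) = c + p·(λ̄ e_1 − Σ_i u_i μ̄_i γ_i) + λ l(λ̄/λ) + Σ_i u_i μ_i l(μ̄_i/μ_i)`. -/
def Hpum {J : ℕ} [NeZero J] (lam c : ℝ) (μ : Fin J → ℝ) (p u : Fin J → ℝ)
    (m : ℝ × (Fin J → ℝ)) : ℝ :=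
  c + dotJ p (fun j => m.1 * (if j = 0 then 1 else 0) - ∑ i, u i * m.2 i * gam J i j)
    + lam * lfun (m.1 / lam) + ∑ i, u i * (μ i * lfun (m.2 i / μ i))

/-- `h(ν,δ) = c + λ(1 − e^{Σ_i ν_i β_i − δ_1}) + Σ_i μ_i(1 − e^{−ν_i β_i + δ_i − δ_{i+1}})`,
with `ν ∈ ℝ^J` and `δ ∈ ℝ^{J+1}`. -/
def hFun {J : ℕ} (lam c : ℝ) (μ β : Fin J → ℝ)
    (q : (Fin J → ℝ) × (Fin (J + 1) → ℝ)) : ℝ :=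
  c + lam * (1 - Real.exp (∑ i, q.1 i * β i - q.2 0)) +
    ∑ i : Fin J, μ i * (1 - Real.exp (-(q.1 i * β i) + q.2 i.castSucc - q.2 i.succ))

/-- The constraint set `S` of pairs `(ν, δ)`. -/
def Sset {J : ℕ} (μ β z x : Fin J → ℝ) :
    Set ((Fin J → ℝ) × (Fin (J + 1) → ℝ)) :=
  {q | q.2 (Fin.last J) = 0 ∧
    (∀ i : Fin J, x i = 0 → 0 ≤ q.2 i.castSucc) ∧
    (∀ i : Fin J, x i = z i → q.2 i.castSucc ≤ 0) ∧
    (∀ i : Fin J, x i ≠ 0 → x i ≠ z i → q.2 i.castSucc = 0) ∧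
    (∀ i ∈ Aset μ z x, 0 ≤ q.1 i) ∧
    (∀ i ∉ Aset μ z x, q.1 i = 0) ∧
    (∑ i, q.1 i) = 1 ∧
    ∀ i : Fin J, -(q.1 i * β i) + q.2 i.castSucc - q.2 i.succ ≤ 0}

/-- `s` = largest (1-indexed) `j ≤ k` with `j ∉ I(x)`, and `s = 0` if none exists. -/
def sIdx {J : ℕ} (x : Fin J → ℝ) (k : Fin J) : ℕ :=
  sSup (insert 0 ((fun j : Fin J => (j : ℕ) + 1) '' {j | j ≤ k ∧ x j ≠ 0}))

/-- `t` = least (1-indexed) `j ∈ [k+1, J]` with `j ∉ B(x)`, and `t = J+1` if none exists. -/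
def tIdx {J : ℕ} (z x : Fin J → ℝ) (k : Fin J) : ℕ :=
  sInf (insert (J + 1) ((fun j : Fin J => (j : ℕ) + 1) '' {j | k < j ∧ x j ≠ z j}))

/-- `δ^{(r,k)}_i = β_k (1_{i ≥ r+1} − 1_{i ≥ k+1})` (1-indexed `i`, `r`; coordinates of
`Fin (J+1)` are the 1-indexed positions shifted by one). -/
def delrk {J : ℕ} (β : Fin J → ℝ) (k : Fin J) (r : ℕ) : Fin (J + 1) → ℝ :=
  fun i => β k * ((if r ≤ (i : ℕ) then 1 else 0) - (if (k : ℕ) + 1 ≤ (i : ℕ) then 1 else 0))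
/-- Monotonicity of `β` in `μ`. -/
lemma beta_mono_aux (lam c m1 m2 b1 b2 : ℝ) (hlam : 0 < lam) (hc : 0 < c) (hm1 : 0 < m1)
    (h1 : 0 < b1) (h2 : 0 < b2)
    (e1 : c + lam * (1 - Real.exp b1) + m1 * (1 - Real.exp (-b1)) = 0)
    (e2 : c + lam * (1 - Real.exp b2) + m2 * (1 - Real.exp (-b2)) = 0)
    (hm : m1 ≤ m2) : b1 ≤ b2 := by
  by_contra hlt
  push Not at hlt
  have hE : Real.exp b2 < Real.exp b1 := Real.exp_lt_exp.mpr hlt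
  have hE' : Real.exp (-b1) < Real.exp (-b2) := Real.exp_lt_exp.mpr (by linarith)
  have p1 : Real.exp b1 * Real.exp (-b1) = 1 := by rw [← Real.exp_add]; simp
  have p2 : Real.exp b2 * Real.exp (-b2) = 1 := by rw [← Real.exp_add]; simp
  have g1 : 1 < Real.exp b1 := by simpa using h1
  have g2 : 1 < Real.exp b2 := by simpa using h2
  have q1 : c = (Real.exp b1 - 1) * (lam - m1 * Real.exp (-b1)) := by
    linear_combination e1 + m1 * p1
  have q2 : c = (Real.exp b2 - 1) * (lam - m2 * Real.exp (-b2)) := by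
    linear_combination e2 + m2 * p2
  have pos2 : 0 < lam - m2 * Real.exp (-b2) := by
    by_contra hn
    push Not at hn
    nlinarith
  have cmp : m1 * Real.exp (-b1) < m2 * Real.exp (-b2) := by
    have := Real.exp_pos (-b2)
    nlinarith
  nlinarith [mul_pos (sub_pos.mpr hE) pos2]

/-- Convexity estimate: the simplex spanned by `0` and the `β_j e_j` lies in `{F ≥ 0}`. -/
lemma simplex_nonneg {J : ℕ} (lam c : ℝ) (μ β t : Fin J → ℝ)
    (hlam : 0 < lam) (hc : 0 < c) (hμ : ∀ i, 0 < μ i)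
    (hβ : ∀ i, c + lam * (1 - Real.exp (β i)) + μ i * (1 - Real.exp (-(β i))) = 0)
    (ht : ∀ i, 0 ≤ t i) (ht1 : ∑ i, t i ≤ 1) :
    0 ≤ c + lam * (1 - Real.exp (∑ i, t i * β i)) +
      ∑ i, μ i * (1 - Real.exp (-(t i * β i))) := by
  have hti : ∀ i, t i ≤ 1 := fun i =>
    (Finset.single_le_sum (fun j _ => ht j) (Finset.mem_univ i)).trans ht1
  have hexp : ∀ i, Real.exp (-(t i * β i)) ≤ (1 - t i) + t i * Real.exp (-(β i)) := by
    intro i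
    have := convexOn_exp.2 (Set.mem_univ (0:ℝ)) (Set.mem_univ (-(β i)))
      (sub_nonneg.mpr (hti i)) (ht i) (by ring)
    simpa using this
  have hsum : Real.exp (∑ i, t i * β i) ≤ (1 - ∑ i, t i) + ∑ i, t i * Real.exp (β i) := by
    have := convexOn_exp.map_sum_le (t := (Finset.univ : Finset (Option (Fin J))))
      (w := fun o => o.elim (1 - ∑ i, t i) t) (p := fun o => o.elim 0 β)
      (by rintro (_ | i) _
          · simpa using ht1
          · exact ht i) (by simp [Fintype.sum_option]) (by simp)
    simpa [Fintype.sum_option] using this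
  have h3 : ∑ i, t i * (μ i * (1 - Real.exp (-(β i)))) ≤
      ∑ i, μ i * (1 - Real.exp (-(t i * β i))) := by
    apply Finset.sum_le_sum
    intro i _
    nlinarith [hexp i, hμ i]
  have h4 : ∑ i, t i * (μ i * (1 - Real.exp (-(β i)))) =
      lam * (∑ i, t i * Real.exp (β i)) - (c + lam) * ∑ i, t i := by
    rw [Finset.mul_sum, Finset.mul_sum, ← Finset.sum_sub_distrib]
    refine Finset.sum_congr rfl fun i _ => ?_
    linear_combination t i * hβ i
  nlinarith [mul_le_mul_of_nonneg_left hsum hlam.le, mul_nonneg hc.le (sub_nonneg.mpr ht1)]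

/-- Abel summation estimate. -/
lemma abel_aux (d W : ℕ → ℝ) (n : ℕ) (h0 : 0 ≤ d 0 * W 0)
    (hs : ∀ j < n, d (j + 1) * (W j - W (j + 1)) ≤ 0) :
    ∑ j ∈ Finset.range (n + 1), (d (j + 1) - d j) * W j ≤ d (n + 1) * W n := by
  induction n with
  | zero => simp; linarith
  | succ n ih =>
    rw [Finset.sum_range_succ]
    have := ih (fun j hj => hs j (by omega))
    have := hs n (by omega)
    linarith

/-- Positions to which mass at `j` may be moved. -/
def reach {J : ℕ} (z x : Fin J → ℝ) (j : Fin J) : Set (Fin J) :=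
  {r | (r ≤ j ∧ ∀ k, r < k → k ≤ j → x k = 0) ∨ (j ≤ r ∧ ∀ k, j < k → k ≤ r → x k = z k)}

lemma reach_self {J : ℕ} (z x : Fin J → ℝ) (j : Fin J) : j ∈ reach z x j :=
  Or.inl ⟨le_refl _, fun _ h1 h2 => absurd h1 (not_lt.mpr h2)⟩

/-- The dual weights. -/
def wmax {J : ℕ} (β z x : Fin J → ℝ) (j : Fin J) : ℝ :=
  sSup ((fun r => (β r)⁻¹) '' reach z x j)

lemma le_wmax {J : ℕ} (β z x : Fin J → ℝ) (j r : Fin J) (h : r ∈ reach z x j) :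
    (β r)⁻¹ ≤ wmax β z x j :=
  le_csSup (Set.toFinite _).bddAbove ⟨r, h, rfl⟩

lemma wmax_le {J : ℕ} (β z x : Fin J → ℝ) (j : Fin J) (a : ℝ)
    (h : ∀ r ∈ reach z x j, (β r)⁻¹ ≤ a) : wmax β z x j ≤ a := by
  apply csSup_le (Set.Nonempty.image _ ⟨j, reach_self z x j⟩)
  rintro _ ⟨r, hr, rfl⟩
  exact h r hr

lemma wmax_mono {J : ℕ} (β z x : Fin J → ℝ) (j k : Fin J)
    (h : reach z x j ⊆ reach z x k) : wmax β z x j ≤ wmax β z x k :=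
  wmax_le _ _ _ _ _ fun r hr => le_wmax _ _ _ _ _ (h hr)

lemma reach_I {J : ℕ} (z x : Fin J → ℝ) (hz : ∀ i, 0 < z i) (j k : Fin J)
    (hjk : (k : ℕ) = j + 1) (hk : x k = 0) : reach z x j ⊆ reach z x k := by
  rintro r (⟨h1, h2⟩ | ⟨h1, h2⟩)
  · left
    refine ⟨by simp only [Fin.le_def] at *; omega, fun l hl hl' => ?_⟩
    by_cases e : l = k
    · rw [e, hk]
    · exact h2 l hl (by simp only [Fin.le_def, Fin.ext_iff] at *; omega)
  · by_cases e : r = j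
    · subst e
      left
      refine ⟨by simp only [Fin.le_def] at *; omega, fun l hl hl' => ?_⟩
      have : l = k := by simp only [Fin.le_def, Fin.lt_def, Fin.ext_iff] at *; omega
      rw [this, hk]
    · exfalso
      have := h2 k (by simp only [Fin.lt_def]; omega)
        (by simp only [Fin.le_def, Fin.ext_iff] at *; omega)
      linarith [hz k]

lemma reach_B {J : ℕ} (z x : Fin J → ℝ) (hz : ∀ i, 0 < z i) (j k : Fin J)
    (hjk : (k : ℕ) = j + 1) (hk : x k = z k) : reach z x k ⊆ reach z x j := by
  rintro r (⟨h1, h2⟩ | ⟨h1, h2⟩)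
  · by_cases e : r = k
    · subst e
      right
      refine ⟨by simp only [Fin.le_def] at *; omega, fun l hl hl' => ?_⟩
      have : l = r := by simp only [Fin.le_def, Fin.lt_def, Fin.ext_iff] at *; omega
      rw [this, hk]
    · exfalso
      have := h2 k (by simp only [Fin.lt_def, Fin.le_def, Fin.ext_iff] at *; omega) le_rfl
      linarith [hz k]
  · right
    refine ⟨by simp only [Fin.le_def] at *; omega, fun l hl hl' => ?_⟩
    by_cases e : l = k
    · rw [e, hk]
    · exact h2 l (by simp only [Fin.lt_def, Fin.ext_iff] at *; omega) hl'

lemma wmax_A {J : ℕ} (μ β z x : Fin J → ℝ) (hβ : ∀ i, 0 < β i)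
    (hmono : ∀ i j, μ i ≤ μ j → β i ≤ β j) (k : Fin J) (hk : k ∈ Aset μ z x) :
    wmax β z x k ≤ (β k)⁻¹ := by
  apply wmax_le
  intro r hr
  apply inv_anti₀ (hβ k)
  apply hmono
  obtain ⟨hA, hB⟩ := hk
  rcases eq_or_ne r k with e | e
  · rw [e]
  rcases hr with ⟨h1, h2⟩ | ⟨h1, h2⟩
  · exact hA r (lt_of_le_of_ne h1 e)
  · have hlt : k < r := lt_of_le_of_ne h1 e.symm
    rcases hB with hB | hB
    · exfalso
      have hlt' := Fin.lt_def.mp hlt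
      have hJ := r.isLt
      have hb : (k : ℕ) + 1 < J := by omega
      exact hB hb (h2 ⟨k + 1, hb⟩ (by simp only [Fin.lt_def]; omega)
        (by simp only [Fin.le_def]; omega))
    · exact (hB r hlt h2).le

/-- The dual estimate `Σ y_j / β_j ≤ 1`. -/
lemma dual_bound (J : ℕ) [NeZero J] (μ z β : Fin J → ℝ) (hz : ∀ i, 0 < z i)
    (hβ : ∀ i, 0 < β i) (hmono : ∀ i j, μ i ≤ μ j → β i ≤ β j)
    (x : Fin J → ℝ) (hx : x ∈ domG z) (q : (Fin J → ℝ) × (Fin (J + 1) → ℝ))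
    (hq : q ∈ Sset μ β z x) :
    ∑ i : Fin J, (q.1 i * β i - q.2 i.castSucc + q.2 i.succ) * (β i)⁻¹ ≤ 1 := by
  obtain ⟨hl, hI, hB, hN, hA, hnA, hs, hy⟩ := hq
  obtain ⟨n, rfl⟩ : ∃ n, J = n + 1 := ⟨J - 1, by have := NeZero.ne J; omega⟩
  set W := wmax β z x with hW
  have hWpos : ∀ i, 0 ≤ W i := fun i =>
    (inv_pos.mpr (hβ i)).le.trans (le_wmax β z x i i (reach_self z x i))
  have step1 : ∑ i : Fin (n+1), (q.1 i * β i - q.2 i.castSucc + q.2 i.succ) * (β i)⁻¹ ≤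
      ∑ i : Fin (n+1), (q.1 i + (q.2 i.succ - q.2 i.castSucc) * W i) := by
    apply Finset.sum_le_sum
    intro i _
    have a1 : (q.1 i * β i - q.2 i.castSucc + q.2 i.succ) * (β i)⁻¹ ≤
        (q.1 i * β i - q.2 i.castSucc + q.2 i.succ) * W i :=
      mul_le_mul_of_nonneg_left (le_wmax β z x i i (reach_self z x i)) (by linarith [hy i])
    have a2 : q.1 i * (β i * W i) ≤ q.1 i := by
      by_cases hi : i ∈ Aset μ z x
      · have b1 := mul_le_mul_of_nonneg_left (wmax_A μ β z x hβ hmono i hi) (hβ i).le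
        rw [mul_inv_cancel₀ (hβ i).ne'] at b1
        exact mul_le_of_le_one_right (hA i hi) b1
      · rw [hnA i hi]; simp
    linarith
  rw [Finset.sum_add_distrib, hs] at step1
  have step2 : ∑ i : Fin (n+1), (q.2 i.succ - q.2 i.castSucc) * W i ≤ 0 := by
    let d : ℕ → ℝ := fun m => if h : m < n + 2 then q.2 ⟨m, h⟩ else 0
    let V : ℕ → ℝ := fun m => if h : m < n + 1 then W ⟨m, h⟩ else 0
    have key := abel_aux d V n ?_ ?_
    · rw [← Fin.sum_univ_eq_sum_range (fun j => (d (j+1) - d j) * V j)] at key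
      have dl : d (n+1) = 0 := by
        simp only [d]
        rw [dif_pos (by omega)]
        exact hl
      rw [dl, zero_mul] at key
      convert key using 2 with i
      have hi := i.isLt
      simp only [d, V]
      rw [dif_pos (by omega), dif_pos (by omega), dif_pos (by omega)]
      rfl
    · apply mul_nonneg
      · simp only [d]
        rw [dif_pos (by omega)]
        change 0 ≤ q.2 (Fin.castSucc (0 : Fin (n+1)))
        by_cases h0 : x 0 = 0
        · exact hI 0 h0
        · exact (hN 0 h0 hx.2.1.ne).ge
      · simp only [V]
        rw [dif_pos (by omega)]
        exact hWpos _
    · intro j hj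
      simp only [d, V]
      rw [dif_pos (by omega), dif_pos (by omega), dif_pos (by omega)]
      have hj1 : j < n + 1 := by omega
      have hj2 : j + 1 < n + 1 := by omega
      change q.2 (Fin.castSucc ⟨j+1, hj2⟩) * (W ⟨j, hj1⟩ - W ⟨j+1, hj2⟩) ≤ 0
      by_cases h0 : x ⟨j+1, hj2⟩ = 0
      · have := wmax_mono β z x _ _ (reach_I z x hz ⟨j, hj1⟩ ⟨j+1, hj2⟩ rfl h0)
        exact mul_nonpos_of_nonneg_of_nonpos (hI _ h0) (by linarith)
      · by_cases h1 : x ⟨j+1, hj2⟩ = z ⟨j+1, hj2⟩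
        · have := wmax_mono β z x _ _ (reach_B z x hz ⟨j, hj1⟩ ⟨j+1, hj2⟩ rfl h1)
          exact mul_nonpos_of_nonpos_of_nonneg (hB _ h1) (by linarith)
        · rw [hN _ h0 h1]; simp
  linarith

lemma dot_gam (J : ℕ) (β ν : Fin J → ℝ) (δ : Fin (J + 1) → ℝ) (hl : δ (Fin.last J) = 0)
    (i : Fin J) :
    dotJ (gam J i) (fun j => -(∑ k, ν k * bvec β k j) + δ j.castSucc) =
      -(ν i * β i) + δ i.castSucc - δ i.succ := by
  have hgen : ∀ p : Fin J → ℝ, dotJ (gam J i) p =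
      p i - if h : (i : ℕ) + 1 < J then p ⟨i + 1, h⟩ else 0 := by
    intro p
    simp only [dotJ, gam, sub_mul, Finset.sum_sub_distrib]
    congr 1
    · simp
    · split_ifs with h
      · rw [Finset.sum_eq_single ⟨(i : ℕ) + 1, h⟩]
        · simp
        · intro b _ hb
          rw [if_neg (fun e => hb (Fin.ext e)), zero_mul]
        · simp
      · apply Finset.sum_eq_zero
        intro b _
        rw [if_neg (by have := b.isLt; omega), zero_mul]
  rw [hgen]
  have hsplit : ∑ k, ν k * bvec β k i =
      ν i * β i + ∑ k, ν k * (if (i : ℕ) + 1 ≤ (k : ℕ) then β k else 0) := by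
    have e : ν i * β i = ∑ k, if k = i then ν k * β k else 0 := by simp
    rw [e, ← Finset.sum_add_distrib]
    refine Finset.sum_congr rfl fun k _ => ?_
    simp only [bvec, Fin.ext_iff]
    split_ifs <;> first | omega | simp
  split_ifs with h
  · have e : δ i.succ = δ (Fin.castSucc ⟨(i : ℕ) + 1, h⟩) := rfl
    rw [hsplit, e]
    simp only [bvec]
    ring
  · have e : i.succ = Fin.last J := by
      ext; have := i.isLt; simp; omega
    rw [hsplit, e, hl, Finset.sum_eq_zero (f := fun k : Fin J =>
      ν k * (if (i : ℕ) + 1 ≤ (k : ℕ) then β k else 0))]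
    · ring
    · intro k _
      rw [if_neg (by have := k.isLt; omega), mul_zero]

/-- `h ≥ 0` on `S`, and for `p = −Σ_i ν_i b_i + δ` with `(ν,δ) ∈ S` the
Hamiltonian satisfies `H(p) = h(ν,δ) ≥ 0`. -/
theorem stmt17 (J : ℕ) [NeZero J] (lam c : ℝ) (μ z β : Fin J → ℝ)
    (hlam : 0 < lam) (hc : 0 < c) (hμ : ∀ i, 0 < μ i) (hz : ∀ i, 0 < z i)
    (hβ : ∀ i, 0 < β i ∧
      c + lam * (1 - Real.exp (β i)) + μ i * (1 - Real.exp (-(β i))) = 0)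
    (x : Fin J → ℝ) (hx : x ∈ domG z) :
    ∀ q ∈ Sset μ β z x,
      0 ≤ hFun lam c μ β q ∧
      Ham lam c μ (fun j => -(∑ i, q.1 i * bvec β i j) + q.2 j.castSucc) =
        hFun lam c μ β q := by
  intro q hq
  have hmono : ∀ i j, μ i ≤ μ j → β i ≤ β j := fun i j hij =>
    beta_mono_aux lam c (μ i) (μ j) (β i) (β j) hlam hc (hμ i) (hβ i).1 (hβ j).1
      (hβ i).2 (hβ j).2 hij
  have hdual := dual_bound J μ z β hz (fun i => (hβ i).1) hmono x hx q hq
  obtain ⟨hl, hI, hB, hN, hA, hnA, hs, hy⟩ := hq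
  constructor
  · have key := simplex_nonneg lam c μ β
      (fun i => (q.1 i * β i - q.2 i.castSucc + q.2 i.succ) * (β i)⁻¹) hlam hc hμ
      (fun i => (hβ i).2)
      (fun i => mul_nonneg (by linarith [hy i]) (inv_pos.mpr (hβ i).1).le) hdual
    have e : ∀ i, (q.1 i * β i - q.2 i.castSucc + q.2 i.succ) * (β i)⁻¹ * β i =
        q.1 i * β i - q.2 i.castSucc + q.2 i.succ := fun i =>
      inv_mul_cancel_right₀ (hβ i).1.ne' _
    simp only [e] at key
    have tel : ∑ i : Fin J, (q.1 i * β i - q.2 i.castSucc + q.2 i.succ) =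
        ∑ i, q.1 i * β i - q.2 0 := by
      have h1 := Fin.sum_univ_succ q.2
      have h2 := Fin.sum_univ_castSucc q.2
      rw [Finset.sum_add_distrib, Finset.sum_sub_distrib]
      linarith
    rw [tel] at key
    unfold hFun
    convert key using 7
    ring
  · unfold Ham hFun
    congr 1
    · congr 4
      have h0 : (Fin.castSucc (0 : Fin J)) = 0 := by ext; simp
      simp [bvec, h0]
      ring
    · refine Finset.sum_congr rfl fun i _ => ?_
      rw [dot_gam J β q.1 q.2 hl i]
      apply max_eq_right
      apply mul_nonneg (hμ i).le
      have := Real.exp_le_one_iff.mpr (hy i)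
      linarith
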